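/- Let d ∈ ℕ, let T, ρ ∈ (0,∞), set ϱ = √(2ρT), let a ∈ ℝ, b ∈ (a,∞), let φ: ℝ^d → ℝ be a function, let u ∈ C^{1,2}([0,T]×ℝ^d, ℝ) be a function with at most polynomially growing partial derivatives which satisfies for every t ∈ [0,T], x ∈ ℝ^d that u(0,x) = φ(x) and ∂u/∂t(t,x) = ρ Δ_x u(t,x), let (Ω,𝔽,ℙ) be a probability space, let 𝕎: Ω → ℝ^d be a standard normal random variable (law equal to the standard Gaussian measure on ℝ^d), let ξ: Ω → [a,b]^d be a uniformly distributed random variable on [a,b]^d, and assume that 𝕎 and ξ are independent. Then the function [a,b]^d ∋ x ↦ u(T,x) ∈ ℝ attains the infimum of the stochastic optimization problem, i.e. E[|φ(ϱ𝕎 + ξ) − u(T,ξ)|²] = inf_{v ∈ C([a,b]^d,ℝ)} E[|φ(ϱ𝕎 + ξ) − v(ξ)|²], and every continuous U: [a,b]^d → ℝ attaining this infimum satisfies U(x) = u(T,x) for all x ∈ [a,b]^d. -/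

import Mathlib

open MeasureTheory ProbabilityTheory Set

noncomputable section

/-- First spatial partial derivative `∂g/∂x_i` of a function `g : ℝ^d → ℝ`. -/
def spatialPD1 (d : ℕ) (g : (Fin d → ℝ) → ℝ) (i : Fin d) (x : Fin d → ℝ) : ℝ :=
  fderiv ℝ g x (Pi.single i 1)

/-- Second spatial partial derivative `∂²g/(∂x_i ∂x_j)` of a function `g : ℝ^d → ℝ`. -/
def spatialPD2 (d : ℕ) (g : (Fin d → ℝ) → ℝ) (i j : Fin d) (x : Fin d → ℝ) : ℝ :=
  fderiv ℝ (fun y => fderiv ℝ g y (Pi.single i 1)) x (Pi.single j 1)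

/-- The Laplacian `Δg` of a function `g : ℝ^d → ℝ`. -/
def laplacian (d : ℕ) (g : (Fin d → ℝ) → ℝ) (x : Fin d → ℝ) : ℝ :=
  ∑ i : Fin d, spatialPD2 d g i i x

/-- `u ∈ C^{1,2}([α,β] × ℝ^d, ℝ)`: `u` is continuous, once continuously differentiable in
the time variable and twice continuously differentiable in the space variable, with all
partial derivatives jointly continuous. -/
def IsC12On (d : ℕ) (α β : ℝ) (u : ℝ → (Fin d → ℝ) → ℝ) : Prop :=
  ContinuousOn (fun p : ℝ × (Fin d → ℝ) => u p.1 p.2) (Icc α β ×ˢ univ) ∧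
  (∀ x, DifferentiableOn ℝ (fun t => u t x) (Icc α β)) ∧
  ContinuousOn (fun p : ℝ × (Fin d → ℝ) =>
    derivWithin (fun s => u s p.2) (Icc α β) p.1) (Icc α β ×ˢ univ) ∧
  (∀ t ∈ Icc α β, ContDiff ℝ 2 (u t)) ∧
  (∀ i : Fin d, ContinuousOn (fun p : ℝ × (Fin d → ℝ) => spatialPD1 d (u p.1) i p.2)
    (Icc α β ×ˢ univ)) ∧
  (∀ i j : Fin d, ContinuousOn (fun p : ℝ × (Fin d → ℝ) => spatialPD2 d (u p.1) i j p.2)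
    (Icc α β ×ˢ univ))

/-- `u` and its time derivative and first and second order spatial partial derivatives grow
at most polynomially on `[0,T] × ℝ^d`. -/
def HasPolyGrowthDerivs (d : ℕ) (T : ℝ) (u : ℝ → (Fin d → ℝ) → ℝ) : Prop :=
  ∃ c q : ℝ, 1 ≤ q ∧ ∀ t ∈ Icc (0:ℝ) T, ∀ x : Fin d → ℝ,
    |u t x| ≤ c * (1 + ∑ i, |x i|) ^ q ∧
    |derivWithin (fun s => u s x) (Icc (0:ℝ) T) t| ≤ c * (1 + ∑ i, |x i|) ^ q ∧
    (∀ i, |spatialPD1 d (u t) i x| ≤ c * (1 + ∑ i, |x i|) ^ q) ∧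
    (∀ i j, |spatialPD2 d (u t) i j x| ≤ c * (1 + ∑ i, |x i|) ^ q)

/-- The standard Gaussian measure on `ℝ^d` (the `d`-fold product of the standard
Gaussian measure on `ℝ`). -/
def stdGaussian (d : ℕ) : Measure (Fin d → ℝ) :=
  Measure.pi fun _ => gaussianReal 0 1

/-- The cube `[a,b]^d ⊆ ℝ^d`. -/
def cube (d : ℕ) (a b : ℝ) : Set (Fin d → ℝ) :=
  Set.univ.pi fun _ => Icc a b

/-- The uniform distribution on the cube `[a,b]^d`, i.e. normalized Lebesgue measure. -/
def uniformCube (d : ℕ) (a b : ℝ) : Measure (Fin d → ℝ) :=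
  (volume (cube d a b))⁻¹ • volume.restrict (cube d a b)

/-- The weight `∏ᵢ (1 + |xᵢ|)`, whose powers dominate all functions of polynomial growth. -/
def growthWeight {d : ℕ} (x : Fin d → ℝ) : ℝ := ∏ i, (1 + |x i|)

lemma one_add_sum_abs_le_growthWeight {d : ℕ} (x : Fin d → ℝ) :
    1 + ∑ i, |x i| ≤ growthWeight x := by
  unfold growthWeight
  induction (Finset.univ : Finset (Fin d)) using Finset.induction_on with
  | empty => simp
  | insert i s hi ih =>
    rw [Finset.sum_insert hi, Finset.prod_insert hi]
    have := abs_nonneg (x i)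
    have := Finset.sum_nonneg fun j (_ : j ∈ s) => abs_nonneg (x j)
    nlinarith

lemma one_le_growthWeight {d : ℕ} (x : Fin d → ℝ) : 1 ≤ growthWeight x := by
  have h := Finset.sum_nonneg fun j (_ : j ∈ Finset.univ) => abs_nonneg (x j)
  linarith [one_add_sum_abs_le_growthWeight x]

lemma abs_apply_le_growthWeight {d : ℕ} (x : Fin d → ℝ) (i : Fin d) :
    |x i| ≤ growthWeight x := by
  have h := Finset.single_le_sum (fun j _ => abs_nonneg (x j)) (Finset.mem_univ i)
  linarith [one_add_sum_abs_le_growthWeight x]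

lemma continuous_growthWeight {d : ℕ} : Continuous (growthWeight (d := d)) := by
  unfold growthWeight
  fun_prop

lemma growthWeight_add_smul_le {d : ℕ} (x w : Fin d → ℝ) (σ : ℝ) :
    growthWeight (x + σ • w) ≤ growthWeight x * (1 + |σ|) ^ d * growthWeight w := by
  have h : (1 + |σ|) ^ d = ∏ _i : Fin d, (1 + |σ|) := by simp
  unfold growthWeight
  rw [h, ← Finset.prod_mul_distrib, ← Finset.prod_mul_distrib]
  refine Finset.prod_le_prod (fun i _ => by positivity) fun i _ => ?_
  have h1 : |(x + σ • w) i| ≤ |x i| + |σ| * |w i| := by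
    simpa [abs_mul] using abs_add_le (x i) (σ * w i)
  have := abs_nonneg (x i)
  have := abs_nonneg (w i)
  have := abs_nonneg σ
  have : 0 ≤ |x i| * |σ| * |w i| := by positivity
  have : 0 ≤ |x i| * |σ| := by positivity
  have : 0 ≤ |x i| * |w i| := by positivity
  nlinarith

lemma rpow_growth_le {d : ℕ} (c q : ℝ) (x : Fin d → ℝ) :
    c * (1 + ∑ i, |x i|) ^ q ≤ |c| * growthWeight x ^ ⌈q⌉₊ := by
  have h1 : (1 : ℝ) ≤ 1 + ∑ i, |x i| := by
    linarith [Finset.sum_nonneg fun j (_ : j ∈ Finset.univ) => abs_nonneg (x j)]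
  have h2 : (1 + ∑ i, |x i|) ^ q ≤ growthWeight x ^ ⌈q⌉₊ := by
    calc (1 + ∑ i, |x i|) ^ q ≤ (1 + ∑ i, |x i|) ^ ((⌈q⌉₊ : ℕ) : ℝ) :=
          Real.rpow_le_rpow_of_exponent_le h1 (Nat.le_ceil q)
      _ = (1 + ∑ i, |x i|) ^ ⌈q⌉₊ := Real.rpow_natCast _ _
      _ ≤ _ := pow_le_pow_left₀ (by linarith) (one_add_sum_abs_le_growthWeight x) _
  have h3 : 0 ≤ (1 + ∑ i, |x i|) ^ q := Real.rpow_nonneg (by linarith) _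
  calc c * (1 + ∑ i, |x i|) ^ q ≤ |c| * (1 + ∑ i, |x i|) ^ q :=
        mul_le_mul_of_nonneg_right (le_abs_self c) h3
    _ ≤ _ := mul_le_mul_of_nonneg_left h2 (abs_nonneg c)

lemma integrable_one_add_abs_pow_gaussianReal (n : ℕ) :
    Integrable (fun t : ℝ => (1 + |t|) ^ n) (gaussianReal 0 1) := by
  have habs : MemLp (fun t : ℝ => |t|) (n : ENNReal) (gaussianReal 0 1) :=
    MemLp.norm (f := fun t : ℝ => t) (memLp_id_gaussianReal' _ (by simp))
  have hone : MemLp (fun _ : ℝ => (1 : ℝ)) (n : ENNReal) (gaussianReal 0 1) := memLp_const 1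
  have h : MemLp (fun t : ℝ => 1 + |t|) (n : ENNReal) (gaussianReal 0 1) := hone.add habs
  refine h.integrable_norm_pow'.congr (ae_of_all _ fun t => ?_)
  simp only [Real.norm_eq_abs]
  rw [abs_of_nonneg (show 0 ≤ 1 + |t| by positivity)]

lemma integrable_gaussianReal_iff {g : ℝ → ℝ} :
    Integrable g (gaussianReal 0 1) ↔ Integrable fun t => g t * gaussianPDFReal 0 1 t := by
  rw [gaussianReal_of_var_ne_zero _ one_ne_zero,
    integrable_withDensity_iff_integrable_smul' (measurable_gaussianPDF _ _)
      (ae_of_all _ fun _ => gaussianPDF_lt_top)]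
  simp [mul_comm]

lemma hasDerivAt_gaussianPDFReal_zero_one (t : ℝ) :
    HasDerivAt (gaussianPDFReal 0 1) (-(t * gaussianPDFReal 0 1 t)) t := by
  rw [gaussianPDFReal_def]
  have h : HasDerivAt (fun x : ℝ => -(x - 0) ^ 2 / (2 * ((1 : NNReal) : ℝ))) (-t) t := by
    have := (((hasDerivAt_id t).sub_const 0).pow 2).neg.div_const (2 * ((1 : NNReal) : ℝ))
    convert! this using 1
    simp only [id, NNReal.coe_one]
    push_cast
    ring
  convert! (h.exp.const_mul (√(2 * Real.pi * ((1 : NNReal) : ℝ)))⁻¹) using 1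
  ring

/-- **Stein's identity** for the standard Gaussian measure on the line. -/
lemma integral_mul_self_gaussianReal {f f' : ℝ → ℝ} {C C' : ℝ} {n : ℕ}
    (hf : ∀ t, HasDerivAt f (f' t) t) (hfb : ∀ t, |f t| ≤ C * (1 + |t|) ^ n)
    (hfb' : ∀ t, |f' t| ≤ C' * (1 + |t|) ^ n) :
    ∫ t, f t * t ∂gaussianReal 0 1 = ∫ t, f' t ∂gaussianReal 0 1 := by
  have hfc : Continuous f := continuous_iff_continuousAt.2 fun t => (hf t).continuousAt
  have hfm : Measurable f' := by
    rw [show f' = deriv f from funext fun t => (hf t).deriv.symm]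
    exact measurable_deriv f
  have hC : 0 ≤ C := by simpa using (abs_nonneg _).trans (hfb 0)
  have hi : Integrable f (gaussianReal 0 1) :=
    ((integrable_one_add_abs_pow_gaussianReal n).const_mul C).mono'
      hfc.aestronglyMeasurable (ae_of_all _ hfb)
  have hi' : Integrable f' (gaussianReal 0 1) :=
    ((integrable_one_add_abs_pow_gaussianReal n).const_mul C').mono'
      hfm.aestronglyMeasurable (ae_of_all _ hfb')
  have hit : Integrable (fun t => f t * t) (gaussianReal 0 1) := by
    refine ((integrable_one_add_abs_pow_gaussianReal (n + 1)).const_mul C).mono'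
      (by fun_prop) (ae_of_all _ fun t => ?_)
    rw [Real.norm_eq_abs, abs_mul, pow_succ, ← mul_assoc]
    exact mul_le_mul (hfb t) (by linarith) (abs_nonneg t) (by positivity)
  rw [integrable_gaussianReal_iff] at hi hi' hit
  have key := integral_mul_deriv_eq_deriv_mul_of_integrable (u := f) (u' := f')
    (fun x _ => hf x) (fun x _ => hasDerivAt_gaussianPDFReal_zero_one x)
    (by
      refine hit.neg.congr (ae_of_all _ fun t => ?_)
      simp only [Pi.neg_apply, Pi.mul_apply]
      ring) hi' hi
  rw [integral_gaussianReal_eq_integral_smul one_ne_zero,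
    integral_gaussianReal_eq_integral_smul one_ne_zero]
  simp only [smul_eq_mul]
  rw [integral_congr_ae (ae_of_all _ fun t => mul_comm (gaussianPDFReal 0 1 t) (f' t)),
    ← neg_eq_iff_eq_neg.2 key, ← integral_neg]
  refine integral_congr_ae (ae_of_all _ fun t => ?_)
  simp only
  ring

instance isProbabilityMeasure_stdGaussian (d : ℕ) :
    IsProbabilityMeasure (_root_.stdGaussian d) := by
  unfold _root_.stdGaussian
  infer_instance

lemma integrable_growthWeight_pow (d n : ℕ) :
    Integrable (fun w : Fin d → ℝ => growthWeight w ^ n) (_root_.stdGaussian d) := by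
  unfold _root_.stdGaussian growthWeight
  simp_rw [← Finset.prod_pow]
  exact Integrable.fintype_prod fun _ => integrable_one_add_abs_pow_gaussianReal n

lemma growthWeight_insertNth {d : ℕ} (i : Fin (d + 1)) (t : ℝ) (y : Fin d → ℝ) :
    growthWeight (i.insertNth t y : Fin (d + 1) → ℝ) = (1 + |t|) * growthWeight y := by
  unfold growthWeight
  rw [Fin.prod_univ_succAbove _ i]
  simp

lemma integral_stdGaussian_succAbove {d : ℕ} (i : Fin (d + 1)) {g : (Fin (d + 1) → ℝ) → ℝ}
    (hg : Integrable g (_root_.stdGaussian (d + 1))) :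
    ∫ w, g w ∂_root_.stdGaussian (d + 1) =
      ∫ y, ∫ t, g (i.insertNth t y) ∂gaussianReal 0 1 ∂_root_.stdGaussian d := by
  have hmp := (measurePreserving_piFinSuccAbove
    (fun _ : Fin (d + 1) => gaussianReal 0 1) i).symm
  have hint := (hmp.integrable_comp_emb (MeasurableEquiv.measurableEmbedding _)).2 hg
  unfold _root_.stdGaussian
  rw [← hmp.integral_comp']
  refine (integral_prod_symm _ hint).trans ?_
  rfl

/-- **Gaussian integration by parts** for functions of polynomial growth. -/
lemma integral_mul_apply_stdGaussian {d : ℕ} (i : Fin d) {f f' : (Fin d → ℝ) → ℝ}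
    {C C' : ℝ} {n : ℕ} (hf : Continuous f) (hf' : Continuous f')
    (hd : ∀ w, HasLineDerivAt ℝ f (f' w) w (Pi.single i 1))
    (hfb : ∀ w, |f w| ≤ C * growthWeight w ^ n) (hfb' : ∀ w, |f' w| ≤ C' * growthWeight w ^ n) :
    ∫ w, f w * w i ∂_root_.stdGaussian d = ∫ w, f' w ∂_root_.stdGaussian d := by
  obtain _ | d := d
  · exact i.elim0
  have hC : 0 ≤ C := by
    have h0 := (abs_nonneg _).trans (hfb 0)
    have : growthWeight (0 : Fin (d + 1) → ℝ) = 1 := by simp [growthWeight]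
    simpa [this] using h0
  have hi' : Integrable f' (_root_.stdGaussian (d + 1)) :=
    ((integrable_growthWeight_pow (d + 1) n).const_mul C').mono'
      hf'.aestronglyMeasurable (ae_of_all _ hfb')
  have hi : Integrable (fun w => f w * w i) (_root_.stdGaussian (d + 1)) := by
    refine ((integrable_growthWeight_pow (d + 1) (n + 1)).const_mul C).mono'
      (by fun_prop) (ae_of_all _ fun w => ?_)
    rw [Real.norm_eq_abs, abs_mul, pow_succ, ← mul_assoc]
    have := one_le_growthWeight w
    exact mul_le_mul (hfb w) (abs_apply_le_growthWeight w i) (abs_nonneg _) (by positivity)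
  rw [integral_stdGaussian_succAbove i hi, integral_stdGaussian_succAbove i hi']
  congr 1 with y
  simp only [Fin.insertNth_apply_same]
  refine integral_mul_self_gaussianReal (C := C * growthWeight y ^ n)
    (C' := C' * growthWeight y ^ n) (n := n) (fun t => ?_) (fun t => ?_) fun t => ?_
  · have h := hd (i.insertNth t y : Fin (d + 1) → ℝ)
    have h2 : HasDerivAt (fun s : ℝ => f (i.insertNth t y + (s - t) • Pi.single i (1 : ℝ)))
        (f' (i.insertNth t y)) t := by
      have h' : HasDerivAt (fun s : ℝ => f (i.insertNth t y + s • Pi.single i (1 : ℝ)))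
        (f' (i.insertNth t y)) (t - t) := by rw [sub_self]; exact h
      exact h'.comp_sub_const t t
    convert! h2 using 3 with s
    ext j
    refine Fin.succAboveCases i ?_ (fun k => ?_) j <;> simp
  · convert hfb (i.insertNth t y) using 1
    rw [growthWeight_insertNth, mul_pow]
    ring
  · convert hfb' (i.insertNth t y) using 1
    rw [growthWeight_insertNth, mul_pow]
    ring

lemma growthWeight_add_smul_pow_le {d : ℕ} (x w : Fin d → ℝ) {σ R : ℝ} (hσ : |σ| ≤ R) (n : ℕ) :
    growthWeight (x + σ • w) ^ n ≤ (growthWeight x * (1 + R) ^ d) ^ n * growthWeight w ^ n := by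
  have hx := one_le_growthWeight x
  have hw := one_le_growthWeight w
  have h0 := one_le_growthWeight (x + σ • w)
  rw [← mul_pow]
  refine pow_le_pow_left₀ (by linarith) ((growthWeight_add_smul_le x w σ).trans ?_) n
  gcongr

/-- Polynomial growth of `u` and its derivatives, in terms of `growthWeight`. -/
lemma HasPolyGrowthDerivs.exists_growthWeight_bound {d : ℕ} {T : ℝ} {u : ℝ → (Fin d → ℝ) → ℝ}
    (h : HasPolyGrowthDerivs d T u) : ∃ (C : ℝ) (n : ℕ), 0 ≤ C ∧ ∀ t ∈ Icc (0:ℝ) T, ∀ x,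
    |u t x| ≤ C * growthWeight x ^ n ∧
    |derivWithin (fun s => u s x) (Icc (0:ℝ) T) t| ≤ C * growthWeight x ^ n ∧
    (∀ i, |spatialPD1 d (u t) i x| ≤ C * growthWeight x ^ n) ∧
    (∀ i j, |spatialPD2 d (u t) i j x| ≤ C * growthWeight x ^ n) := by
  obtain ⟨c, q, -, h⟩ := h
  refine ⟨|c|, ⌈q⌉₊, abs_nonneg c, fun t ht x => ?_⟩
  obtain ⟨h0, h1, h2, h3⟩ := h t ht x
  have hb := rpow_growth_le c q x
  exact ⟨h0.trans hb, h1.trans hb, fun i => (h2 i).trans hb, fun i j => (h3 i j).trans hb⟩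

lemma fderiv_eq_sum_spatialPD1 {d : ℕ} (g : (Fin d → ℝ) → ℝ) (x : Fin d → ℝ) :
    fderiv ℝ g x =
      ∑ i, spatialPD1 d g i x • (ContinuousLinearMap.proj i : (Fin d → ℝ) →L[ℝ] ℝ) := by
  ext v
  have hv : v = ∑ i, v i • (Pi.single i (1 : ℝ) : Fin d → ℝ) := by
    ext j
    simp [Finset.sum_apply, Pi.single_apply]
  conv_lhs => rw [hv]
  simp [spatialPD1, mul_comm]

/-- Chain rule for a `C^{1,2}` function along a differentiable curve in the interior of the
time interval. -/
lemma IsC12On.hasDerivAt_comp {d : ℕ} {α β : ℝ} {u : ℝ → (Fin d → ℝ) → ℝ} (hu : IsC12On d α β u)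
    {τ : ℝ → ℝ} {γ : ℝ → Fin d → ℝ} {s τ' : ℝ} {γ' : Fin d → ℝ} (hτ : HasDerivAt τ τ' s)
    (hγ : HasDerivAt γ γ' s) (hs : τ s ∈ Ioo α β) :
    HasDerivAt (fun r => u (τ r) (γ r))
      (τ' * derivWithin (fun r => u r (γ s)) (Icc α β) (τ s) +
        ∑ i, spatialPD1 d (u (τ s)) i (γ s) * γ' i) s := by
  obtain ⟨-, hdt, hct, hx, hc1, -⟩ := hu
  have hnhds : Icc α β ×ˢ (univ : Set (Fin d → ℝ)) ∈ nhds (τ s, γ s) :=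
    prod_mem_nhds (Icc_mem_nhds hs.1 hs.2) Filter.univ_mem
  have hev : ∀ᶠ v : ℝ × (Fin d → ℝ) in nhds (τ s, γ s), v.1 ∈ Ioo α β :=
    (continuous_fst.tendsto (τ s, γ s)).eventually (Ioo_mem_nhds hs.1 hs.2)
  have key := hasStrictFDerivAt_uncurry_coprod (𝕜 := ℝ) (u := (τ s, γ s)) (f := u)
    (f₁ := fun t x => ContinuousLinearMap.toSpanSingleton ℝ
      (derivWithin (fun r => u r x) (Icc α β) t))
    (f₂ := fun t x => ∑ i, spatialPD1 d (u t) i x •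
      (ContinuousLinearMap.proj i : (Fin d → ℝ) →L[ℝ] ℝ))
    (by
      filter_upwards [hev] with v hv
      have hn : Icc α β ∈ nhds v.1 := Icc_mem_nhds hv.1 hv.2
      exact ((hdt v.2 v.1 (Ioo_subset_Icc_self hv)).hasDerivWithinAt.hasDerivAt hn).hasFDerivAt)
    (by
      filter_upwards [hev] with v hv
      have := ((hx v.1 (Ioo_subset_Icc_self hv)).differentiable two_ne_zero v.2).hasFDerivAt
      rwa [fderiv_eq_sum_spatialPD1] at this)
    (by
      have hL : Continuous fun y : ℝ => ContinuousLinearMap.toSpanSingleton ℝ y :=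
        (ContinuousLinearMap.toSpanSingletonLE ℝ ℝ ℝ).toLinearMap.continuous_of_finiteDimensional
      exact hL.continuousAt.comp (hct.continuousAt hnhds))
    (by
      have h := fun i => (hc1 i).continuousAt hnhds
      change ContinuousAt (fun p : ℝ × (Fin d → ℝ) => ∑ i, spatialPD1 d (u p.1) i p.2 •
        (ContinuousLinearMap.proj i : (Fin d → ℝ) →L[ℝ] ℝ)) (τ s, γ s)
      fun_prop)
  have := key.hasFDerivAt.comp_hasDerivAt s (hτ.prodMk hγ)
  convert! this using 1
  simp [Function.HasUncurry.uncurry]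

lemma ContDiff.hasLineDerivAt_spatialPD1_comp {d : ℕ} {g : (Fin d → ℝ) → ℝ} (hg : ContDiff ℝ 2 g)
    (x : Fin d → ℝ) (σ : ℝ) (i : Fin d) (w : Fin d → ℝ) :
    HasLineDerivAt ℝ (fun w => spatialPD1 d g i (x + σ • w))
      (σ * spatialPD2 d g i i (x + σ • w)) w (Pi.single i 1) := by
  have h1 : ContDiff ℝ 1 fun y => fderiv ℝ g y (Pi.single i 1) :=
    (hg.fderiv_right (m := 1) (by norm_num)).clm_apply contDiff_const
  have h2 := (h1.differentiable one_ne_zero (x + σ • w)).hasFDerivAt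
  have h3 : HasFDerivAt (fun w : Fin d → ℝ => x + σ • w)
      (σ • ContinuousLinearMap.id ℝ (Fin d → ℝ)) w :=
    ((hasFDerivAt_id w).const_smul σ).const_add x
  convert! (h2.comp w h3).hasLineDerivAt (Pi.single i 1) using 1
  simp [spatialPD2]

lemma IsC12On.continuous_spatialPD2 {d : ℕ} {α β : ℝ} {u : ℝ → (Fin d → ℝ) → ℝ}
    (hu : IsC12On d α β u) {t : ℝ} (ht : t ∈ Icc α β) (i j : Fin d) :
    Continuous (spatialPD2 d (u t) i j) :=
  (hu.2.2.2.2.2 i j).comp_continuous (f := fun x => (t, x)) (by fun_prop) fun x => ⟨ht, mem_univ _⟩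

lemma IsC12On.continuous_spatialPD1 {d : ℕ} {α β : ℝ} {u : ℝ → (Fin d → ℝ) → ℝ}
    (hu : IsC12On d α β u) {t : ℝ} (ht : t ∈ Icc α β) (i : Fin d) :
    Continuous (spatialPD1 d (u t) i) :=
  (hu.2.2.2.2.1 i).comp_continuous (f := fun x => (t, x)) (by fun_prop) fun x => ⟨ht, mem_univ _⟩

lemma IsC12On.continuous_apply {d : ℕ} {α β : ℝ} {u : ℝ → (Fin d → ℝ) → ℝ}
    (hu : IsC12On d α β u) {t : ℝ} (ht : t ∈ Icc α β) : Continuous (u t) :=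
  (hu.2.2.2.1 t ht).continuous

/-- **Feynman–Kac formula for the heat equation**: a solution of polynomial growth is the
Gaussian average of its initial value. -/
lemma heat_terminal_eq_integral {d : ℕ} {T ρ : ℝ} (hT : 0 < T) (hρ : 0 < ρ)
    {u : ℝ → (Fin d → ℝ) → ℝ} (hu : IsC12On d 0 T u) (hgrowth : HasPolyGrowthDerivs d T u)
    (hpde : ∀ t ∈ Icc (0:ℝ) T, ∀ x,
      derivWithin (fun s => u s x) (Icc (0:ℝ) T) t = ρ * laplacian d (u t) x)
    (x : Fin d → ℝ) :
    ∫ w, u 0 (x + √(2 * ρ * T) • w) ∂_root_.stdGaussian d = u T x := by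
  obtain ⟨C, n, hC, hbound⟩ := hgrowth.exists_growthWeight_bound
  set R := √(2 * ρ * T) with hR
  have hR0 : 0 ≤ R := Real.sqrt_nonneg _
  set K := C * (growthWeight x * (1 + R) ^ d) ^ n with hK
  have hx1 := one_le_growthWeight x
  have hK0 : 0 ≤ K := by positivity
  have hCK : ∀ σ, |σ| ≤ R → ∀ w : Fin d → ℝ,
      C * growthWeight (x + σ • w) ^ n ≤ K * growthWeight w ^ n := fun σ hσ w => by
    rw [hK, mul_assoc]
    exact mul_le_mul_of_nonneg_left (growthWeight_add_smul_pow_le x w hσ n) hC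
  have hσR : ∀ s ∈ Icc (0:ℝ) T, |√(2 * ρ * s)| ≤ R := fun s hs => by
    rw [abs_of_nonneg (Real.sqrt_nonneg _)]
    exact Real.sqrt_le_sqrt (by nlinarith [hs.2])
  have hTs : ∀ s ∈ Icc (0:ℝ) T, T - s ∈ Icc (0:ℝ) T := fun s hs => by
    constructor <;> linarith [hs.1, hs.2]
  have hintK : ∀ (c : ℝ) (m : ℕ),
      Integrable (fun w : Fin d → ℝ => c * growthWeight w ^ m) (_root_.stdGaussian d) :=
    fun c m => (integrable_growthWeight_pow d m).const_mul c
  have hcont : ContinuousOn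
      (fun s => ∫ w, u (T - s) (x + √(2 * ρ * s) • w) ∂_root_.stdGaussian d) (Icc 0 T) := by
    refine continuousOn_of_dominated (bound := fun w => K * growthWeight w ^ n)
      (fun s hs => ?_) (fun s hs => ae_of_all _ fun w => ?_) (hintK K n) (ae_of_all _ fun w => ?_)
    · exact ((hu.continuous_apply (hTs s hs)).comp (by fun_prop)).aestronglyMeasurable
    · exact (hbound _ (hTs s hs) _).1.trans (hCK _ (hσR s hs) w)
    · exact hu.1.comp (f := fun s => (T - s, x + √(2 * ρ * s) • w)) (by fun_prop)
        fun s hs => ⟨hTs s hs, mem_univ _⟩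
  have hderiv : ∀ s ∈ Ioo (0:ℝ) T, HasDerivAt
      (fun s => ∫ w, u (T - s) (x + √(2 * ρ * s) • w) ∂_root_.stdGaussian d) 0 s := by
    intro s₀ hs₀
    set F' : ℝ → (Fin d → ℝ) → ℝ := fun s w =>
      -1 * derivWithin (fun r => u r (x + √(2 * ρ * s) • w)) (Icc 0 T) (T - s) +
        ∑ i, spatialPD1 d (u (T - s)) i (x + √(2 * ρ * s) • w) * ((ρ / √(2 * ρ * s)) • w) i
      with hF'
    have hmem : ∀ s ∈ Ioo (s₀ / 2) T, s ∈ Icc (0:ℝ) T := fun s hs =>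
      ⟨by linarith [hs.1, hs₀.1], hs.2.le⟩
    have hF'c : ∀ s ∈ Icc (0:ℝ) T, Continuous (F' s) := fun s hs => by
      have h1 : Continuous fun w : Fin d → ℝ =>
          derivWithin (fun r => u r (x + √(2 * ρ * s) • w)) (Icc 0 T) (T - s) :=
        hu.2.2.1.comp_continuous (f := fun w => (T - s, x + √(2 * ρ * s) • w)) (by fun_prop)
          fun w => ⟨hTs s hs, mem_univ _⟩
      have h2 := fun i => hu.continuous_spatialPD1 (hTs s hs) i
      simp only [hF']
      fun_prop
    have main := hasDerivAt_integral_of_dominated_loc_of_deriv_le (μ := _root_.stdGaussian d)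
      (F := fun s w => u (T - s) (x + √(2 * ρ * s) • w)) (F' := F') (x₀ := s₀)
      (s := Ioo (s₀ / 2) T)
      (bound := fun w => K * growthWeight w ^ n +
        ∑ _i : Fin d, K * (ρ / √(2 * ρ * (s₀ / 2))) * growthWeight w ^ (n + 1))
      (Ioo_mem_nhds (by linarith [hs₀.1]) hs₀.2)
      (by
        filter_upwards [Ioo_mem_nhds hs₀.1 hs₀.2] with s hs
        exact ((hu.continuous_apply (hTs s (Ioo_subset_Icc_self hs))).comp
          (by fun_prop)).aestronglyMeasurable)
      ((hintK K n).mono' ((hu.continuous_apply (hTs s₀ (Ioo_subset_Icc_self hs₀))).comp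
          (by fun_prop)).aestronglyMeasurable (ae_of_all _ fun w =>
          (hbound _ (hTs s₀ (Ioo_subset_Icc_self hs₀)) _).1.trans
            (hCK _ (hσR s₀ (Ioo_subset_Icc_self hs₀)) w)))
      (hF'c s₀ (Ioo_subset_Icc_self hs₀)).aestronglyMeasurable
      (ae_of_all _ fun w s hs => by
        have hb := hbound _ (hTs s (hmem s hs)) (x + √(2 * ρ * s) • w)
        have hk := hCK _ (hσR s (hmem s hs)) w
        have hw := one_le_growthWeight w
        refine norm_add_le_of_le ?_ (norm_sum_le_of_le _ fun i _ => ?_)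
        · rw [norm_mul, norm_neg, norm_one, one_mul]
          exact hb.2.1.trans hk
        · rw [norm_mul, Pi.smul_apply, norm_smul, pow_succ]
          have e1 : ‖spatialPD1 d (u (T - s)) i (x + √(2 * ρ * s) • w)‖ ≤ K * growthWeight w ^ n :=
            (hb.2.2.1 i).trans hk
          have e2 : ‖ρ / √(2 * ρ * s)‖ ≤ ρ / √(2 * ρ * (s₀ / 2)) := by
            rw [Real.norm_of_nonneg (by positivity)]
            have := hs₀.1
            have := hs.1
            gcongr
          have e3 : ‖w i‖ ≤ growthWeight w := abs_apply_le_growthWeight w i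
          calc _ ≤ K * growthWeight w ^ n * (ρ / √(2 * ρ * (s₀ / 2)) * growthWeight w) := by
                gcongr
            _ = _ := by ring)
      ((hintK K n).add (integrable_finsetSum _ fun _ _ => hintK _ _))
      (ae_of_all _ fun w s hs => by
        have hs0 : 0 < s := by linarith [hs.1, hs₀.1]
        have hsq : HasDerivAt (fun s => √(2 * ρ * s)) (ρ / √(2 * ρ * s)) s := by
          have := ((hasDerivAt_id s).const_mul (2 * ρ)).sqrt (by simp only [id]; positivity)
          convert! this using 1
          simp only [id]
          rw [mul_one, mul_div_mul_left _ _ two_ne_zero]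
        exact hu.hasDerivAt_comp (τ := fun s => T - s) (γ := fun s => x + √(2 * ρ * s) • w)
          ((hasDerivAt_id s).const_sub T) ((hsq.smul_const w).const_add x)
          ⟨by linarith [hs.2], by linarith⟩)
    obtain ⟨-, main⟩ := main
    have hs₀' := Ioo_subset_Icc_self hs₀
    set σ := √(2 * ρ * s₀) with hσ
    have hσ0 : 0 < σ := Real.sqrt_pos.2 (by have := hs₀.1; positivity)
    have hb := fun w => hbound _ (hTs s₀ hs₀') (x + σ • w)
    have hk := fun w => hCK _ (hσR s₀ hs₀') w
    have hparts : ∀ i, ∫ w, spatialPD1 d (u (T - s₀)) i (x + σ • w) * w i ∂_root_.stdGaussian d =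
        ∫ w, σ * spatialPD2 d (u (T - s₀)) i i (x + σ • w) ∂_root_.stdGaussian d := fun i =>
      integral_mul_apply_stdGaussian i (C := K) (C' := σ * K) (n := n)
        ((hu.continuous_spatialPD1 (hTs s₀ hs₀') i).comp (by fun_prop))
        (((hu.continuous_spatialPD2 (hTs s₀ hs₀') i i).comp (by fun_prop)).const_mul σ)
        ((hu.2.2.2.1 _ (hTs s₀ hs₀')).hasLineDerivAt_spatialPD1_comp x σ i)
        (fun w => ((hb w).2.2.1 i).trans (hk w))
        (fun w => by
          rw [abs_mul, abs_of_pos hσ0, mul_assoc]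
          exact mul_le_mul_of_nonneg_left (((hb w).2.2.2 i i).trans (hk w)) hσ0.le)
    have hint1 : ∀ i, Integrable (fun w => spatialPD1 d (u (T - s₀)) i (x + σ • w) * w i)
        (_root_.stdGaussian d) := fun i => by
      have hc := hu.continuous_spatialPD1 (hTs s₀ hs₀') i
      refine (hintK K (n + 1)).mono' (by fun_prop) (ae_of_all _ fun w => ?_)
      have hw := one_le_growthWeight w
      rw [norm_mul, pow_succ, ← mul_assoc]
      exact mul_le_mul (((hb w).2.2.1 i).trans (hk w)) (abs_apply_le_growthWeight w i)
        (norm_nonneg _) (by positivity)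
    have hint2 : ∀ i, Integrable (fun w => spatialPD2 d (u (T - s₀)) i i (x + σ • w))
        (_root_.stdGaussian d) := fun i => by
      have hc := hu.continuous_spatialPD2 (hTs s₀ hs₀') i i
      exact (hintK K n).mono' (by fun_prop) (ae_of_all _ fun w =>
        ((hb w).2.2.2 i i).trans (hk w))
    have hzero : ∫ w, F' s₀ w ∂_root_.stdGaussian d = 0 := by
      have e : ∀ w, F' s₀ w =
          ∑ i, ((ρ / σ) * (spatialPD1 d (u (T - s₀)) i (x + σ • w) * w i) -
            ρ * spatialPD2 d (u (T - s₀)) i i (x + σ • w)) := fun w => by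
        simp only [hF']
        rw [hpde _ (hTs s₀ hs₀'), laplacian, Finset.sum_sub_distrib, ← hσ]
        simp only [Pi.smul_apply, smul_eq_mul]
        rw [neg_one_mul, neg_add_eq_sub, Finset.mul_sum]
        congr 1
        exact Finset.sum_congr rfl fun i _ => by ring
      simp_rw [e]
      refine (integral_finsetSum _ fun i _ =>
        ((hint1 i).const_mul (ρ / σ)).sub ((hint2 i).const_mul ρ)).trans
          (Finset.sum_eq_zero fun i _ => ?_)
      simp only [Pi.sub_apply]
      rw [integral_sub ((hint1 i).const_mul _) ((hint2 i).const_mul _), integral_const_mul,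
        integral_const_mul, hparts i, integral_const_mul]
      field_simp
      ring
    rwa [hzero] at main
  obtain ⟨c, -, hc⟩ := exists_hasDerivAt_eq_slope _ (fun _ => 0) hT hcont hderiv
  rw [sub_zero, eq_comm, div_eq_zero_iff, or_iff_left hT.ne', sub_eq_zero] at hc
  simpa using hc

/-- Pythagorean identity for the `L²` error of approximating `f (w, x)` by a function of `x`, in
terms of the fibrewise mean `m` of `f`. -/
lemma integral_sq_sub_eq_add_of_integral_eq {E F : Type*} [MeasurableSpace E] [MeasurableSpace F]
    {μ : Measure E} {ν : Measure F} [IsProbabilityMeasure μ] [IsProbabilityMeasure ν]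
    {f : E × F → ℝ} {m v : F → ℝ} (hf : MemLp f 2 (μ.prod ν)) (hm : MemLp m 2 ν)
    (hv : MemLp v 2 ν) (hmean : ∀ x, ∫ w, f (w, x) ∂μ = m x) :
    ∫ p, |f p - v p.2| ^ 2 ∂μ.prod ν =
      ∫ p, |f p - m p.2| ^ 2 ∂μ.prod ν + ∫ x, |m x - v x| ^ 2 ∂ν := by
  have hm' : MemLp (fun p : E × F => m p.2) 2 (μ.prod ν) := hm.comp_snd μ
  have hk : MemLp (fun x => m x - v x) 2 ν := hm.sub hv
  have hk' : MemLp (fun p : E × F => m p.2 - v p.2) 2 (μ.prod ν) := hk.comp_snd μ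
  have hg : MemLp (fun p => f p - m p.2) 2 (μ.prod ν) := hf.sub hm'
  have hgk : Integrable (fun p => (f p - m p.2) * (m p.2 - v p.2)) (μ.prod ν) :=
    hg.integrable_mul hk'
  have hcross : ∫ p, (f p - m p.2) * (m p.2 - v p.2) ∂μ.prod ν = 0 := by
    rw [integral_prod_symm _ hgk]
    refine integral_eq_zero_of_ae ?_
    filter_upwards [(hf.integrable one_le_two).prod_left_ae] with x hx
    rw [integral_mul_const, integral_sub hx (integrable_const _), hmean x]
    simp
  have hsnd : ∫ x, |m x - v x| ^ 2 ∂ν = ∫ p, (m p.2 - v p.2) ^ 2 ∂μ.prod ν := by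
    rw [integral_fun_snd (fun x => (m x - v x) ^ 2)]
    simp
  simp_rw [hsnd, sq_abs]
  rw [← integral_add hg.integrable_sq hk'.integrable_sq]
  have := integral_add (hg.integrable_sq.add hk'.integrable_sq) (hgk.const_mul 2)
  rw [integral_const_mul, hcross, mul_zero, add_zero] at this
  refine Eq.trans (integral_congr_ae (ae_of_all _ fun p => ?_)) this
  simp only [Pi.add_apply]
  ring

lemma isCompact_cube (d : ℕ) (a b : ℝ) : IsCompact (cube d a b) :=
  isCompact_univ_pi fun _ => isCompact_Icc

lemma measurableSet_cube (d : ℕ) (a b : ℝ) : MeasurableSet (cube d a b) :=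
  (isCompact_cube d a b).isClosed.measurableSet

lemma uniformCube_absolutelyContinuous (d : ℕ) (a b : ℝ) :
    uniformCube d a b ≪ volume.restrict (cube d a b) :=
  Measure.smul_absolutelyContinuous

lemma restrict_cube_absolutelyContinuous_uniformCube (d : ℕ) (a b : ℝ) :
    volume.restrict (cube d a b) ≪ uniformCube d a b :=
  Measure.absolutelyContinuous_smul
    (ENNReal.inv_ne_zero.2 (isCompact_cube d a b).measure_lt_top.ne)

lemma ae_mem_cube (d : ℕ) (a b : ℝ) : ∀ᵐ x ∂uniformCube d a b, x ∈ cube d a b :=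
  (uniformCube_absolutelyContinuous d a b).ae_le (ae_restrict_mem (measurableSet_cube d a b))

lemma ContinuousOn.memLp_uniformCube {d : ℕ} {a b : ℝ} [IsFiniteMeasure (uniformCube d a b)]
    {v : (Fin d → ℝ) → ℝ} (hv : ContinuousOn v (cube d a b)) (p : ENNReal) :
    MemLp v p (uniformCube d a b) := by
  obtain ⟨C, hC⟩ := (isCompact_cube d a b).exists_bound_of_continuousOn hv
  refine MemLp.of_bound ((hv.aestronglyMeasurable (measurableSet_cube d a b)).mono_ac
    (uniformCube_absolutelyContinuous d a b)) C ?_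
  filter_upwards [ae_mem_cube d a b] with x hx using hC x hx

lemma cube_subset_closure_interior (d : ℕ) {a b : ℝ} (hab : a < b) :
    cube d a b ⊆ closure (interior (cube d a b)) := by
  unfold cube
  rw [interior_pi_set finite_univ, closure_pi_set]
  simp [closure_Ioo hab.ne]

lemma eqOn_cube_of_integral_sq_sub_eq_zero {d : ℕ} {a b : ℝ} (hab : a < b)
    [IsFiniteMeasure (uniformCube d a b)] {v m : (Fin d → ℝ) → ℝ}
    (hv : ContinuousOn v (cube d a b)) (hm : ContinuousOn m (cube d a b))
    (h : ∫ x, |m x - v x| ^ 2 ∂uniformCube d a b = 0) : EqOn v m (cube d a b) := by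
  have hint : Integrable (fun x => |m x - v x| ^ 2) (uniformCube d a b) := by
    simp_rw [sq_abs]
    exact ((hm.memLp_uniformCube 2).sub (hv.memLp_uniformCube 2)).integrable_sq
  rw [integral_eq_zero_iff_of_nonneg (fun x => by positivity) hint] at h
  refine Measure.eqOn_of_ae_eq (μ := volume) ?_ hv hm (cube_subset_closure_interior d hab)
  filter_upwards [(restrict_cube_absolutelyContinuous_uniformCube d a b).ae_le h] with x hx
  have h0 : m x - v x = 0 := by simpa using hx
  linarith

lemma memLp_two_smul_add_of_growth {d : ℕ} {a b : ℝ} [IsFiniteMeasure (uniformCube d a b)]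
    {g : (Fin d → ℝ) → ℝ} (hg : Continuous g) {C : ℝ} {n : ℕ}
    (hb : ∀ x, |g x| ≤ C * growthWeight x ^ n) (σ : ℝ) :
    MemLp (fun p : (Fin d → ℝ) × (Fin d → ℝ) => g (σ • p.1 + p.2)) 2
      ((_root_.stdGaussian d).prod (uniformCube d a b)) := by
  obtain ⟨M, hM⟩ := (isCompact_cube d a b).exists_bound_of_continuousOn
    (continuous_growthWeight (d := d)).continuousOn
  have hC : 0 ≤ C := by
    have h0 := (abs_nonneg _).trans (hb 0)
    have : growthWeight (0 : Fin d → ℝ) = 1 := by simp [growthWeight]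
    simpa [this] using h0
  rw [memLp_two_iff_integrable_sq (by fun_prop)]
  refine (((integrable_growthWeight_pow d (2 * n)).const_mul
    ((C * (M * (1 + |σ|) ^ d) ^ n) ^ 2)).comp_fst (uniformCube d a b)).mono' (by fun_prop) ?_
  have hmem : ∀ᵐ p ∂(_root_.stdGaussian d).prod (uniformCube d a b), p.2 ∈ cube d a b :=
    Measure.quasiMeasurePreserving_snd.ae (ae_mem_cube d a b)
  filter_upwards [hmem] with p hp
  have hx := one_le_growthWeight p.2
  have hw := one_le_growthWeight p.1
  have hxM : growthWeight p.2 ≤ M := (le_abs_self _).trans (hM _ hp)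
  have key : |g (σ • p.1 + p.2)| ≤ C * (M * (1 + |σ|) ^ d) ^ n * growthWeight p.1 ^ n := by
    rw [add_comm, mul_assoc]
    refine (hb _).trans (mul_le_mul_of_nonneg_left ?_ hC)
    refine (growthWeight_add_smul_pow_le p.2 p.1 le_rfl n).trans ?_
    gcongr
  rw [Real.norm_of_nonneg (sq_nonneg _), ← sq_abs, mul_comm 2 n, pow_mul, ← mul_pow]
  exact pow_le_pow_left₀ (abs_nonneg _) key 2

/-- **The terminal value of the heat equation solution is the unique minimizer of the
stochastic optimization problem.** -/
theorem heat_min_is_terminal_value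
    (d : ℕ) (hd : 0 < d) (T ρ ϱ : ℝ) (hT : 0 < T) (hρ : 0 < ρ)
    (hϱ : ϱ = Real.sqrt (2 * ρ * T))
    (a b : ℝ) (hab : a < b)
    (φ : (Fin d → ℝ) → ℝ) (u : ℝ → (Fin d → ℝ) → ℝ)
    (hu : IsC12On d 0 T u) (hgrowth : HasPolyGrowthDerivs d T u)
    (hinit : ∀ x, u 0 x = φ x)
    (hpde : ∀ t ∈ Icc (0:ℝ) T, ∀ x,
      derivWithin (fun s => u s x) (Icc (0:ℝ) T) t = ρ * laplacian d (u t) x)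
    {Ω : Type*} [MeasurableSpace Ω] (P : Measure Ω) [IsProbabilityMeasure P]
    (W ξ : Ω → (Fin d → ℝ)) (hW : Measurable W) (hξ : Measurable ξ)
    (hWlaw : Measure.map W P = stdGaussian d)
    (hξval : ∀ ω, ξ ω ∈ cube d a b)
    (hξlaw : Measure.map ξ P = uniformCube d a b)
    (hindep : IndepFun W ξ P) :
    ((∫ ω, |φ (ϱ • W ω + ξ ω) - u T (ξ ω)| ^ 2 ∂P) =
        ⨅ v : {v : (Fin d → ℝ) → ℝ // ContinuousOn v (cube d a b)},
          ∫ ω, |φ (ϱ • W ω + ξ ω) - v.1 (ξ ω)| ^ 2 ∂P) ∧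
      ∀ U : (Fin d → ℝ) → ℝ,
        ContinuousOn U (cube d a b) →
        ((∫ ω, |φ (ϱ • W ω + ξ ω) - U (ξ ω)| ^ 2 ∂P) =
          ⨅ v : {v : (Fin d → ℝ) → ℝ // ContinuousOn v (cube d a b)},
            ∫ ω, |φ (ϱ • W ω + ξ ω) - v.1 (ξ ω)| ^ 2 ∂P) →
        ∀ x ∈ cube d a b, U x = u T x := by
  have : IsProbabilityMeasure (uniformCube d a b) :=
    hξlaw ▸ Measure.isProbabilityMeasure_map hξ.aemeasurable
  have h0 : (0 : ℝ) ∈ Icc 0 T := ⟨le_rfl, hT.le⟩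
  have hφ : u 0 = φ := funext hinit
  have hφc : Continuous φ := hφ ▸ hu.continuous_apply h0
  have hm : ContinuousOn (u T) (cube d a b) :=
    (hu.continuous_apply ⟨hT.le, le_rfl⟩).continuousOn
  obtain ⟨C, n, -, hbound⟩ := hgrowth.exists_growthWeight_bound
  have hf : MemLp (fun p : (Fin d → ℝ) × (Fin d → ℝ) => φ (ϱ • p.1 + p.2)) 2
      ((_root_.stdGaussian d).prod (uniformCube d a b)) :=
    memLp_two_smul_add_of_growth hφc (fun x => hφ ▸ (hbound 0 h0 x).1) ϱ
  have hmean : ∀ x, ∫ w, φ (ϱ • w + x) ∂_root_.stdGaussian d = u T x := fun x => by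
    rw [← heat_terminal_eq_integral hT hρ hu hgrowth hpde x, hφ, hϱ]
    simp_rw [add_comm x]
  have hlaw : P.map (fun ω => (W ω, ξ ω)) =
      (_root_.stdGaussian d).prod (uniformCube d a b) := by
    rw [hindep.map_prod_eq_prod_map_map hW.aemeasurable hξ.aemeasurable, hWlaw, hξlaw]
  have hrisk : ∀ v, ContinuousOn v (cube d a b) →
      ∫ ω, |φ (ϱ • W ω + ξ ω) - v (ξ ω)| ^ 2 ∂P =
        ∫ p, |φ (ϱ • p.1 + p.2) - v p.2| ^ 2
          ∂(_root_.stdGaussian d).prod (uniformCube d a b) := fun v hv => by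
    rw [← hlaw, integral_map (hW.prodMk hξ).aemeasurable]
    rw [hlaw]
    exact ((hf.aestronglyMeasurable.sub
      ((hv.memLp_uniformCube 2).comp_snd _).aestronglyMeasurable).norm).pow 2
  have hdecomp : ∀ v, ContinuousOn v (cube d a b) →
      ∫ ω, |φ (ϱ • W ω + ξ ω) - v (ξ ω)| ^ 2 ∂P =
        ∫ ω, |φ (ϱ • W ω + ξ ω) - u T (ξ ω)| ^ 2 ∂P +
          ∫ x, |u T x - v x| ^ 2 ∂uniformCube d a b := fun v hv => by
    rw [hrisk v hv, hrisk _ hm]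
    exact integral_sq_sub_eq_add_of_integral_eq hf (hm.memLp_uniformCube 2)
      (hv.memLp_uniformCube 2) hmean
  have hmin : (∫ ω, |φ (ϱ • W ω + ξ ω) - u T (ξ ω)| ^ 2 ∂P) =
      ⨅ v : {v : (Fin d → ℝ) → ℝ // ContinuousOn v (cube d a b)},
        ∫ ω, |φ (ϱ • W ω + ξ ω) - v.1 (ξ ω)| ^ 2 ∂P := by
    have : Nonempty {v : (Fin d → ℝ) → ℝ // ContinuousOn v (cube d a b)} := ⟨⟨u T, hm⟩⟩
    refine le_antisymm (le_ciInf fun v => ?_) (ciInf_le ⟨0, ?_⟩ (⟨u T, hm⟩ :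
      {v : (Fin d → ℝ) → ℝ // ContinuousOn v (cube d a b)}))
    · rw [hdecomp v.1 v.2]
      exact le_add_of_nonneg_right (integral_nonneg fun x => by positivity)
    · rintro _ ⟨v, rfl⟩
      exact integral_nonneg fun ω => by positivity
  refine ⟨hmin, fun U hU hUmin => ?_⟩
  rw [← hmin, hdecomp U hU, add_eq_left] at hUmin
  exact eqOn_cube_of_integral_sq_sub_eq_zero hab hU hm hUmin

end
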